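/- arXiv:1202.0958 — 4 statements merged into one kernel-verified Lean document; each statement's English description precedes it below -/
import Mathlib

section
/- Directed information equals a relative entropy: for probability measures built from a causal input distribution P_{0,n}(dx^n|y^{n-1}) = ⊗_{i=0}^n p_i(dx_i|x^{i-1},y^{i-1}) and a forward channel Q_{0,n}(dy^n|x^n) = ⊗_{i=0}^n q_i(dy_i|y^{i-1},x^i) on finite products of standard Borel spaces, one has I(X^n→Y^n) := Σ_{i=0}^n I(X^i; Y_i | Y^{i-1}) = D(P_{0,n}⊗Q_{0,n} ‖ P_{0,n}⊗ν_{0,n}), where ν_{0,n} is the Y^n-marginal of the joint measure P_{0,n}⊗Q_{0,n} and P_{0,n}⊗ν_{0,n} denotes the measure with the same causal input distribution but output distribution ν_{0,n} independent of the input increments. -/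
open MeasureTheory ProbabilityTheory ENNReal Classical

noncomputable def klDiv {Z : Type*} [MeasurableSpace Z] (P R : Measure Z) : ℝ≥0∞ :=
  if P ≪ R ∧ Integrable (llr P R) P then ENNReal.ofReal (∫ z, llr P R z ∂P) else ⊤

/-- Conditional mutual information `I(A;B|Z)` of the two last components of a measure `ρ`
on `Z × A × B` given the first: the relative entropy of `ρ` with respect to the measure
obtained by making `A` and `B` conditionally independent given `Z`. -/
noncomputable def condMI {Z A B : Type*} [MeasurableSpace Z]
    [MeasurableSpace A] [StandardBorelSpace A] [Nonempty A]
    [MeasurableSpace B] [StandardBorelSpace B] [Nonempty B]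
    (ρ : Measure (Z × A × B)) [IsFiniteMeasure ρ] : ℝ≥0∞ :=
  klDiv ρ ((ρ.map Prod.fst) ⊗ₘ
    ((ρ.map fun w => (w.1, w.2.1)).condKernel ×ₖ (ρ.map fun w => (w.1, w.2.2)).condKernel))

variable {X Y : ℕ → Type*}
  [∀ n, MeasurableSpace (X n)] [∀ n, MeasurableSpace (Y n)]
  [∀ n, StandardBorelSpace (X n)] [∀ n, StandardBorelSpace (Y n)]
  [∀ n, Nonempty (X n)] [∀ n, Nonempty (Y n)]

/-- One step of the interleaved causal construction: extend a measure on
`(X₀×⋯×X_{n-1}) × (Y₀×⋯×Y_{n-1})` by `p_n(dx_n|x^{n-1},y^{n-1}) ⊗ q_n(dy_n|y^{n-1},x^n)`. -/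
noncomputable def stepMeasure (n : ℕ)
    (p : Kernel ((∀ i : Fin n, X i) × (∀ i : Fin n, Y i)) (X n))
    (q : Kernel ((∀ i : Fin n, Y i) × (∀ i : Fin (n + 1), X i)) (Y n))
    (m : Measure ((∀ i : Fin n, X i) × (∀ i : Fin n, Y i))) :
    Measure ((∀ i : Fin (n + 1), X i) × (∀ i : Fin (n + 1), Y i)) :=
  m.bind fun xy => (p xy).bind fun xn =>
    (q (xy.2, Fin.snoc xy.1 xn)).map fun yn => (Fin.snoc xy.1 xn, Fin.snoc xy.2 yn)

/-- The interleaved joint measure `P_{0,n-1} ⊗ Q_{0,n-1} = ⊗_{i=0}^{n-1} p_i ⊗ q_i`. -/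
noncomputable def jointUpTo
    (p : ∀ n : ℕ, Kernel ((∀ i : Fin n, X i) × (∀ i : Fin n, Y i)) (X n))
    (q : ∀ n : ℕ, Kernel ((∀ i : Fin n, Y i) × (∀ i : Fin (n + 1), X i)) (Y n)) :
    ∀ n : ℕ, Measure ((∀ i : Fin n, X i) × (∀ i : Fin n, Y i))
  | 0 => Measure.dirac (fun i => i.elim0, fun i => i.elim0)
  | n + 1 => stepMeasure n (p n) (q n) (jointUpTo p q n)

lemma klDiv_eq_informationTheory_klDiv {Z : Type*} [MeasurableSpace Z] (P R : Measure Z)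
    [IsProbabilityMeasure P] [IsProbabilityMeasure R] :
    klDiv P R = InformationTheory.klDiv P R := by
  rw [klDiv, InformationTheory.klDiv_def]
  simp

lemma klDiv_map_of_leftInverse {Z W : Type*} [MeasurableSpace Z] [MeasurableSpace W]
    (P R : Measure Z) [IsFiniteMeasure P] [IsFiniteMeasure R] {f : Z → W} {g : W → Z}
    (hf : Measurable f) (hg : Measurable g) (hgf : Function.LeftInverse g f) :
    InformationTheory.klDiv (P.map f) (R.map f) = InformationTheory.klDiv P R := by
  refine le_antisymm (InformationTheory.klDiv_map_le P R hf) ?_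
  have h := InformationTheory.klDiv_map_le (P.map f) (R.map f) hg
  rwa [Measure.map_map hg hf, Measure.map_map hg hf, hgf.comp_eq_id, Measure.map_id,
    Measure.map_id] at h

lemma condMI_congr {Z A B : Type*} [MeasurableSpace Z]
    [MeasurableSpace A] [StandardBorelSpace A] [Nonempty A]
    [MeasurableSpace B] [StandardBorelSpace B] [Nonempty B]
    {ρ ρ' : Measure (Z × A × B)} [IsFiniteMeasure ρ] [IsFiniteMeasure ρ'] (h : ρ = ρ') :
    condMI ρ = condMI ρ' := by
  subst h
  rfl

/-- If `η` is a regular version of the conditional law of `B` given `Z`, the conditional mutual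
information of `A` and `B` given `Z` compares the conditional law of `B` given `(Z, A)`
with `η`. -/
lemma condMI_map_prodAssoc_compProd {Z A B : Type*} [MeasurableSpace Z]
    [MeasurableSpace A] [StandardBorelSpace A] [Nonempty A]
    [MeasurableSpace B] [StandardBorelSpace B] [Nonempty B]
    (μ : Measure (Z × A)) [IsProbabilityMeasure μ] (κ : Kernel (Z × A) B) [IsMarkovKernel κ]
    (η : Kernel Z B) [IsMarkovKernel η]
    (h : (μ ⊗ₘ κ).map (fun w => (w.1.1, w.2)) = μ.fst ⊗ₘ η) :
    condMI ((μ ⊗ₘ κ).map MeasurableEquiv.prodAssoc)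
      = InformationTheory.klDiv (μ ⊗ₘ κ) (μ ⊗ₘ η.comap Prod.fst measurable_fst) := by
  have : IsProbabilityMeasure ((μ ⊗ₘ κ).map
      (MeasurableEquiv.prodAssoc (α := Z) (β := A) (γ := B))) :=
    Measure.isProbabilityMeasure_map (by fun_prop)
  have h1 : ((μ ⊗ₘ κ).map MeasurableEquiv.prodAssoc).map Prod.fst = μ.fst := by
    rw [Measure.map_map (by fun_prop) (by fun_prop), Measure.fst]
    conv_rhs => rw [← Measure.fst_compProd μ κ, Measure.fst,
      Measure.map_map (by fun_prop) (by fun_prop)]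
    rfl
  have h2 : ((μ ⊗ₘ κ).map MeasurableEquiv.prodAssoc).map (fun w => (w.1, w.2.1)) = μ := by
    rw [Measure.map_map (by fun_prop) (by fun_prop)]
    conv_rhs => rw [← Measure.fst_compProd μ κ, Measure.fst]
    rfl
  have h3 : ((μ ⊗ₘ κ).map MeasurableEquiv.prodAssoc).map (fun w => (w.1, w.2.2))
      = μ.fst ⊗ₘ η := by
    rw [Measure.map_map (by fun_prop) (by fun_prop), ← h]
    rfl
  have h4 : μ.fst ⊗ₘ (μ.condKernel ×ₖ (μ.fst ⊗ₘ η).condKernel)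
      = (μ ⊗ₘ η.comap Prod.fst measurable_fst).map MeasurableEquiv.prodAssoc := by
    have hη : (μ.fst ⊗ₘ η).condKernel =ᵐ[μ.fst] η := condKernel_compProd μ.fst η
    have hprod : (μ.condKernel ×ₖ (μ.fst ⊗ₘ η).condKernel) =ᵐ[μ.fst] (μ.condKernel ×ₖ η) := by
      filter_upwards [hη] with z hz
      rw [Kernel.prod_apply, Kernel.prod_apply, hz]
    rw [Measure.compProd_congr hprod]
    conv_rhs => rw [← μ.disintegrate μ.condKernel, Measure.compProd_assoc']
    congr 1
    ext z : 1
    rw [Kernel.prod_apply, Kernel.compProd_apply_eq_compProd_sectR, ← Measure.compProd_const]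
    rfl
  unfold condMI
  simp only [h1]
  have key : ∀ (ρ₁ : Measure (Z × A)) (ρ₂ : Measure (Z × B)) [IsFiniteMeasure ρ₁]
      [IsFiniteMeasure ρ₂], ρ₁ = μ → ρ₂ = μ.fst ⊗ₘ η →
      μ.fst ⊗ₘ (ρ₁.condKernel ×ₖ ρ₂.condKernel)
        = μ.fst ⊗ₘ (μ.condKernel ×ₖ (μ.fst ⊗ₘ η).condKernel) := by
    rintro _ _ _ _ rfl rfl
    rfl
  rw [key _ _ h2 h3, h4]
  have : IsProbabilityMeasure ((μ ⊗ₘ η.comap Prod.fst measurable_fst).map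
      (MeasurableEquiv.prodAssoc (α := Z) (β := A) (γ := B))) :=
    Measure.isProbabilityMeasure_map (by fun_prop)
  rw [klDiv_eq_informationTheory_klDiv]
  exact klDiv_map_of_leftInverse _ _ (MeasurableEquiv.measurable _)
    MeasurableEquiv.prodAssoc.symm.measurable (MeasurableEquiv.symm_apply_apply _)

section Truncation

variable {X Y : ℕ → Type*}

/-- Restriction of a finite sequence to its first `k` entries. -/
def truncate {k m : ℕ} (h : k ≤ m) (x : ∀ i : Fin m, X i) : ∀ i : Fin k, X i :=
  fun j => x (Fin.castLE h j)

/-- Append an entry to a finite sequence. -/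
def append (k : ℕ) (x : ∀ i : Fin k, X i) (a : X k) : ∀ i : Fin (k + 1), X i :=
  Fin.snoc (α := fun i : Fin (k + 1) => X i) x a

lemma append_castLE {k : ℕ} (h : k ≤ k + 1) (x : ∀ i : Fin k, X i) (a : X k) (j : Fin k) :
    append k x a (Fin.castLE h j) = x j :=
  Fin.snoc_castSucc (α := fun i : Fin (k + 1) => X i) a x j

lemma append_last {k : ℕ} (x : ∀ i : Fin k, X i) (a : X k) :
    append k x a (Fin.last k) = a :=
  Fin.snoc_last (α := fun i : Fin (k + 1) => X i) a x

lemma truncate_append {k : ℕ} (h : k ≤ k + 1) (x : ∀ i : Fin k, X i) (a : X k) :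
    truncate h (append k x a) = x :=
  funext fun j => append_castLE h x a j

variable [∀ n, MeasurableSpace (X n)] [∀ n, MeasurableSpace (Y n)]

@[fun_prop]
lemma measurable_truncate {k m : ℕ} (h : k ≤ m) : Measurable (truncate (X := X) h) :=
  measurable_pi_iff.mpr fun j => measurable_pi_apply (Fin.castLE h j)

lemma measurable_append (k : ℕ) :
    Measurable fun w : (∀ i : Fin k, X i) × X k => append k w.1 w.2 := by
  refine measurable_pi_iff.mpr fun j => ?_
  induction j using Fin.lastCases with
  | last =>
    simp only [append_last]
    exact measurable_snd
  | cast j =>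
    have : (fun w : (∀ i : Fin k, X i) × X k => append k w.1 w.2 j.castSucc) = fun w => w.1 j :=
      funext fun w => append_castLE k.le_succ w.1 w.2 j
    rw [this]
    exact (measurable_pi_apply j).comp measurable_fst

@[fun_prop]
lemma Measurable.append {α : Type*} [MeasurableSpace α] {k : ℕ} {f : α → ∀ i : Fin k, X i}
    {g : α → X k} (hf : Measurable f) (hg : Measurable g) :
    Measurable fun w => _root_.append k (f w) (g w) :=
  (measurable_append k).comp (hf.prodMk hg)

/-- Append an input to the past inputs and outputs, putting the outputs first. -/
def appendInput (k : ℕ) (w : ((∀ i : Fin k, X i) × (∀ i : Fin k, Y i)) × X k) :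
    (∀ i : Fin k, Y i) × (∀ i : Fin (k + 1), X i) :=
  (w.1.2, append k w.1.1 w.2)

/-- Append an output to the past outputs and current inputs, putting the inputs first. -/
def appendOutput (k : ℕ) (w : ((∀ i : Fin k, Y i) × (∀ i : Fin (k + 1), X i)) × Y k) :
    (∀ i : Fin (k + 1), X i) × (∀ i : Fin (k + 1), Y i) :=
  (w.1.2, append k w.1.1 w.2)

@[fun_prop]
lemma measurable_appendInput (k : ℕ) : Measurable (appendInput (X := X) (Y := Y) k) := by
  unfold appendInput
  fun_prop

@[fun_prop]
lemma measurable_appendOutput (k : ℕ) : Measurable (appendOutput (X := X) (Y := Y) k) := by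
  unfold appendOutput
  fun_prop

/-- The law of `(y^{k-1}, x^k)` when `m` is the law of `(x^{k-1}, y^{k-1})` and `p` gives the
law of the next input. -/
noncomputable def inputStep {k : ℕ}
    (m : Measure ((∀ i : Fin k, X i) × (∀ i : Fin k, Y i)))
    (p : Kernel ((∀ i : Fin k, X i) × (∀ i : Fin k, Y i)) (X k)) :
    Measure ((∀ i : Fin k, Y i) × (∀ i : Fin (k + 1), X i)) :=
  (m ⊗ₘ p).map (appendInput k)

instance {k : ℕ} (m : Measure ((∀ i : Fin k, X i) × (∀ i : Fin k, Y i)))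
    [IsProbabilityMeasure m]
    (p : Kernel ((∀ i : Fin k, X i) × (∀ i : Fin k, Y i)) (X k)) [IsMarkovKernel p] :
    IsProbabilityMeasure (inputStep m p) :=
  Measure.isProbabilityMeasure_map (by fun_prop)

lemma stepMeasure_eq_map_compProd {k : ℕ}
    (p : Kernel ((∀ i : Fin k, X i) × (∀ i : Fin k, Y i)) (X k)) [IsMarkovKernel p]
    (q : Kernel ((∀ i : Fin k, Y i) × (∀ i : Fin (k + 1), X i)) (Y k)) [IsMarkovKernel q]
    (m : Measure ((∀ i : Fin k, X i) × (∀ i : Fin k, Y i))) [IsProbabilityMeasure m] :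
    stepMeasure k p q m = (inputStep m p ⊗ₘ q).map (appendOutput k) := by
  let K := ((Kernel.id ×ₖ q).map (appendOutput k)).comap (appendInput k)
    (measurable_appendInput k)
  have hK : ∀ w, K w = (q (appendInput k w)).map fun y => appendOutput k (appendInput k w, y) := by
    intro w
    rw [Kernel.comap_apply, Kernel.map_apply _ (measurable_appendOutput k), Kernel.prod_apply,
      Kernel.id_apply, Measure.dirac_prod, Measure.map_map (by fun_prop) (by fun_prop)]
    rfl
  have hstep : stepMeasure k p q m = m.bind (K ∘ₖ (Kernel.id ×ₖ p)) := by
    unfold stepMeasure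
    congr 1
    funext xy
    rw [Kernel.comp_apply, Kernel.prod_apply, Kernel.id_apply, Measure.dirac_prod]
    ext s hs
    rw [Measure.bind_apply hs K.aemeasurable,
      lintegral_map (K.measurable_coe hs) (by fun_prop)]
    trans ((p xy).bind fun xn => K (xy, xn)) s
    · congr 2
      exact funext fun xn => (hK (xy, xn)).symm
    · exact Measure.bind_apply hs (K.measurable.comp measurable_prodMk_left).aemeasurable
  rw [hstep, ← Measure.comp_assoc, ← Measure.compProd_eq_comp_prod, inputStep]
  ext s hs
  rw [Measure.bind_apply hs K.aemeasurable, Measure.map_apply (by fun_prop) hs,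
    Measure.compProd_apply (measurable_appendOutput k hs),
    lintegral_map (Kernel.measurable_kernel_prodMk_left (measurable_appendOutput k hs))
      (by fun_prop)]
  refine lintegral_congr fun w => ?_
  rw [hK, Measure.map_apply (by fun_prop) hs]
  rfl

section Joint

variable (p : ∀ k : ℕ, Kernel ((∀ i : Fin k, X i) × (∀ i : Fin k, Y i)) (X k))
  (q : ∀ k : ℕ, Kernel ((∀ i : Fin k, Y i) × (∀ i : Fin (k + 1), X i)) (Y k))
  [∀ k, IsMarkovKernel (p k)] [∀ k, IsMarkovKernel (q k)]

instance isProbabilityMeasure_jointUpTo (k : ℕ) : IsProbabilityMeasure (jointUpTo p q k) := by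
  induction k with
  | zero => exact Measure.dirac.isProbabilityMeasure
  | succ k ih =>
    rw [jointUpTo, stepMeasure_eq_map_compProd]
    exact Measure.isProbabilityMeasure_map (by fun_prop)

lemma jointUpTo_succ (k : ℕ) :
    jointUpTo p q (k + 1) = (inputStep (jointUpTo p q k) (p k) ⊗ₘ q k).map (appendOutput k) :=
  stepMeasure_eq_map_compProd _ _ _

lemma jointUpTo_succ_map_truncate (k : ℕ) :
    (jointUpTo p q (k + 1)).map (Prod.map (truncate k.le_succ) (truncate k.le_succ))
      = jointUpTo p q k := by
  rw [jointUpTo_succ, Measure.map_map (by fun_prop) (by fun_prop)]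
  have h1 : Prod.map (truncate k.le_succ) (truncate k.le_succ) ∘ appendOutput (X := X) (Y := Y) k
      = (fun w => (truncate k.le_succ w.2, w.1)) ∘ Prod.fst :=
    funext fun w => Prod.ext rfl (truncate_append k.le_succ w.1.1 w.2)
  have h2 : (fun w => (truncate k.le_succ w.2, w.1)) ∘ appendInput (X := X) (Y := Y) k
      = Prod.fst :=
    funext fun w => Prod.ext (truncate_append k.le_succ w.1.1 w.2) rfl
  rw [h1, ← Measure.map_map (by fun_prop) (by fun_prop), ← Measure.fst, Measure.fst_compProd,
    inputStep, Measure.map_map (by fun_prop) (by fun_prop), h2, ← Measure.fst,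
    Measure.fst_compProd]

lemma jointUpTo_map_truncate {k m : ℕ} (h : k ≤ m) :
    (jointUpTo p q m).map (Prod.map (truncate h) (truncate h)) = jointUpTo p q k := by
  induction m, h using Nat.le_induction with
  | base => exact Measure.map_id
  | succ m h ih =>
    rw [← ih, ← jointUpTo_succ_map_truncate p q m,
      Measure.map_map (by fun_prop) (by fun_prop)]
    rfl

lemma jointUpTo_succ_map_past (k : ℕ) :
    (jointUpTo p q (k + 1)).map (fun w => truncate k.le_succ w.2)
      = (inputStep (jointUpTo p q k) (p k)).fst := by
  rw [jointUpTo_succ, Measure.map_map (by fun_prop) (by fun_prop)]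
  have h : (fun w : (∀ i : Fin (k + 1), X i) × (∀ i : Fin (k + 1), Y i) =>
      truncate k.le_succ w.2) ∘ appendOutput k = Prod.fst ∘ Prod.fst :=
    funext fun w => truncate_append k.le_succ w.1.1 w.2
  rw [h, ← Measure.map_map (by fun_prop) (by fun_prop)]
  exact congrArg Measure.fst (Measure.fst_compProd _ _)

lemma jointUpTo_succ_map_outputs (k : ℕ) :
    (jointUpTo p q (k + 1)).map (fun w => (truncate k.le_succ w.2, w.2 (Fin.last k)))
      = (inputStep (jointUpTo p q k) (p k) ⊗ₘ q k).map (fun w => (w.1.1, w.2)) := by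
  rw [jointUpTo_succ, Measure.map_map (by fun_prop) (by fun_prop)]
  congr 1
  exact funext fun w =>
    Prod.ext (truncate_append k.le_succ w.1.1 w.2) (append_last w.1.1 w.2)

lemma jointUpTo_succ_map_reorder (k : ℕ) :
    (jointUpTo p q (k + 1)).map (fun w => (truncate k.le_succ w.2, w.1, w.2 (Fin.last k)))
      = (inputStep (jointUpTo p q k) (p k) ⊗ₘ q k).map MeasurableEquiv.prodAssoc := by
  rw [jointUpTo_succ, Measure.map_map (by fun_prop) (by fun_prop)]
  congr 1
  exact funext fun w => Prod.ext (truncate_append k.le_succ w.1.1 w.2)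
    (Prod.ext rfl (append_last w.1.1 w.2))

/-- Changing the output kernels: the divergence accumulates one conditional divergence per
step. -/
lemma klDiv_jointUpTo_succ
    (q' : ∀ k : ℕ, Kernel ((∀ i : Fin k, Y i) × (∀ i : Fin (k + 1), X i)) (Y k))
    [∀ k, IsMarkovKernel (q' k)] (k : ℕ) :
    InformationTheory.klDiv (jointUpTo p q (k + 1)) (jointUpTo p q' (k + 1))
      = InformationTheory.klDiv (jointUpTo p q k) (jointUpTo p q' k)
        + InformationTheory.klDiv (inputStep (jointUpTo p q k) (p k) ⊗ₘ q k)
            (inputStep (jointUpTo p q k) (p k) ⊗ₘ q' k) := by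
  rw [jointUpTo_succ, jointUpTo_succ,
    klDiv_map_of_leftInverse _ _ (measurable_appendOutput k)
      (g := fun w => ((truncate k.le_succ w.2, w.1), w.2 (Fin.last k))) (by fun_prop)
      (fun w => Prod.ext (Prod.ext (truncate_append k.le_succ w.1.1 w.2) rfl)
        (append_last w.1.1 w.2)),
    InformationTheory.klDiv_compProd_eq_add, inputStep, inputStep,
    klDiv_map_of_leftInverse _ _ (measurable_appendInput k)
      (g := fun w => ((truncate k.le_succ w.2, w.1), w.2 (Fin.last k))) (by fun_prop)
      (fun w => Prod.ext (Prod.ext (truncate_append k.le_succ w.1.1 w.2) rfl)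
        (append_last w.1.1 w.2)),
    InformationTheory.klDiv_compProd_left]

end Joint

end Truncation

/-- Directed information equals a relative entropy:
`I(Xⁿ→Yⁿ) = Σ_{i=0}^n I(Xⁱ;Y_i|Yⁱ⁻¹) = D(P_{0,n}⊗Q_{0,n} ‖ P_{0,n}⊗ν_{0,n})`,
where `ν_{0,n} = ⊗_i ν_i` is the causal factorization of the `Yⁿ`-marginal of the joint
measure `π = P_{0,n}⊗Q_{0,n}` (each `ν_i` a regular conditional distribution of `Y_i`
given `Y^{i-1}` under `π`), and `P_{0,n}⊗ν_{0,n}` keeps the causal input distribution but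
makes the output distribution independent of the input increments. -/
theorem directedInfo_eq_klDiv (n : ℕ)
    (p : ∀ k : ℕ, Kernel ((∀ i : Fin k, X i) × (∀ i : Fin k, Y i)) (X k))
    (q : ∀ k : ℕ, Kernel ((∀ i : Fin k, Y i) × (∀ i : Fin (k + 1), X i)) (Y k))
    (hp : ∀ k, IsMarkovKernel (p k)) (hq : ∀ k, IsMarkovKernel (q k))
    (π : Measure ((∀ i : Fin (n + 1), X i) × (∀ i : Fin (n + 1), Y i)))
    [IsProbabilityMeasure π] (hπ : π = jointUpTo p q (n + 1))
    (ν : ∀ k : ℕ, Kernel (∀ i : Fin k, Y i) (Y k)) (hν : ∀ k, IsMarkovKernel (ν k))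
    (hνcond : ∀ k : Fin (n + 1),
      π.map (fun w => ((fun j : Fin (k : ℕ) => w.2 (Fin.castLE k.isLt.le j)), w.2 k))
        = (π.map fun w => fun j : Fin (k : ℕ) => w.2 (Fin.castLE k.isLt.le j)) ⊗ₘ ν k) :
    ∑ k : Fin (n + 1), condMI (π.map fun w =>
        ((fun j : Fin (k : ℕ) => w.2 (Fin.castLE k.isLt.le j)),
          ((fun j : Fin ((k : ℕ) + 1) => w.1 (Fin.castLE k.isLt j)), w.2 k)))
      = klDiv π (jointUpTo p (fun m => Kernel.comap (ν m) Prod.fst measurable_fst) (n + 1)) := by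
  subst hπ
  have hmarg : ∀ k (hk : k < n + 1), (jointUpTo p q (n + 1)).map
      (Prod.map (truncate hk) (truncate hk)) = jointUpTo p q (k + 1) :=
    fun k hk => jointUpTo_map_truncate p q hk
  have hcond : ∀ k, k < n + 1 →
      (inputStep (jointUpTo p q k) (p k) ⊗ₘ q k).map (fun w => (w.1.1, w.2))
        = (inputStep (jointUpTo p q k) (p k)).fst ⊗ₘ ν k := by
    intro k hk
    rw [← jointUpTo_succ_map_outputs, ← jointUpTo_succ_map_past p q, ← hmarg k hk,
      Measure.map_map (by fun_prop) (by fun_prop), Measure.map_map (by fun_prop) (by fun_prop)]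
    exact hνcond ⟨k, hk⟩
  rw [klDiv_eq_informationTheory_klDiv]
  have hsum : ∀ m, m ≤ n + 1 → InformationTheory.klDiv (jointUpTo p q m)
      (jointUpTo p (fun m => Kernel.comap (ν m) Prod.fst measurable_fst) m)
      = ∑ k : Fin m, InformationTheory.klDiv (inputStep (jointUpTo p q k) (p k) ⊗ₘ q k)
          (inputStep (jointUpTo p q k) (p k) ⊗ₘ
            Kernel.comap (ν k) Prod.fst measurable_fst) := by
    intro m hm
    induction m with
    | zero => exact InformationTheory.klDiv_self _
    | succ m ih =>
      rw [klDiv_jointUpTo_succ, ih (by lia), Fin.sum_univ_castSucc]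
      rfl
  rw [hsum (n + 1) le_rfl]
  refine Finset.sum_congr rfl fun k _ => ?_
  have : IsProbabilityMeasure ((inputStep (jointUpTo p q k) (p k) ⊗ₘ q k).map
      MeasurableEquiv.prodAssoc) := Measure.isProbabilityMeasure_map (by fun_prop)
  rw [← condMI_map_prodAssoc_compProd _ _ _ (hcond k k.isLt)]
  refine condMI_congr ?_
  rw [← jointUpTo_succ_map_reorder, ← hmarg k k.isLt,
    Measure.map_map (by fun_prop) (by fun_prop)]
  rfl
end

section
/- If Y is a compact Polish space and X is a Polish space with μ a fixed probability measure on X, then the set of joint probability measures {μ⊗Q : Q a Markov kernel from X to Y} is weakly compact (equivalently, sequentially compact in the topology of weak convergence): it is tight and closed under weak limits. -/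
open MeasureTheory ProbabilityTheory

/-- A probability measure on `X × Y`, with `Y` standard Borel, is of the form `μ ⊗ₘ Q` for a Markov
kernel `Q` if and only if its first marginal is `μ`. -/
lemma exists_isMarkovKernel_eq_compProd_iff_fst_eq
    {X Y : Type*} [MeasurableSpace X] [MeasurableSpace Y] [StandardBorelSpace Y]
    {μ : Measure X} [SFinite μ] (π : Measure (X × Y)) [IsProbabilityMeasure π] :
    (∃ Q : Kernel X Y, IsMarkovKernel Q ∧ π = μ ⊗ₘ Q) ↔ π.fst = μ := by
  refine ⟨?_, ?_⟩
  · rintro ⟨Q, hQ, h⟩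
    rw [h, Measure.fst_compProd]
  · rintro rfl
    have : Nonempty Y := π.nonempty_of_neZero.map Prod.snd
    exact ⟨π.condKernel, inferInstance, (π.disintegrate π.condKernel).symm⟩

/-- The set of probability measures on `X × Y` with a given first marginal is weakly closed. -/
lemma isClosed_setOf_fst_eq
    {X Y : Type*} [MeasurableSpace X] [TopologicalSpace X] [HasOuterApproxClosed X] [BorelSpace X]
    [MeasurableSpace Y] [TopologicalSpace Y] [OpensMeasurableSpace (X × Y)]
    (μ : Measure X) [IsProbabilityMeasure μ] :
    IsClosed {π : ProbabilityMeasure (X × Y) | (π : Measure (X × Y)).fst = μ} := by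
  let ν : ProbabilityMeasure X := ⟨μ, inferInstance⟩
  have h := isClosed_eq (ProbabilityMeasure.continuous_map (continuous_fst (X := X) (Y := Y)))
    (continuous_const (y := ν))
  convert h using 3 with π
  exact ProbabilityMeasure.toMeasure_injective.eq_iff (a := π.map _) (b := ν)

/-- A set of measures on `X × Y`, with `Y` compact, is tight if all its elements have the same first
marginal, a finite measure on a Polish space. -/
lemma isTightMeasureSet_of_fst_eq
    {X Y : Type*} [MeasurableSpace X] [TopologicalSpace X] [PolishSpace X] [BorelSpace X]
    [MeasurableSpace Y] [TopologicalSpace Y] [CompactSpace Y]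
    {μ : Measure X} [IsFiniteMeasure μ] {S : Set (Measure (X × Y))} (hS : ∀ π ∈ S, π.fst = μ) :
    IsTightMeasureSet S :=
  .prodMk (isTightMeasureSet_singleton.subset (Set.image_subset_iff.2 hS)) .of_compactSpace

/-- For a fixed input probability measure `μ` on a Polish space `X` and a compact Polish
output space `Y`, the set of joint probability measures `{μ ⊗ Q : Q Markov kernel}` is
compact in the topology of weak convergence. -/
theorem isCompact_joints_of_compact_output
    {X Y : Type*} [MeasurableSpace X] [TopologicalSpace X] [PolishSpace X] [BorelSpace X]
    [MeasurableSpace Y] [TopologicalSpace Y] [PolishSpace Y] [BorelSpace Y] [CompactSpace Y]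
    (μ : Measure X) [IsProbabilityMeasure μ] :
    IsCompact {π : ProbabilityMeasure (X × Y) |
      ∃ Q : Kernel X Y, IsMarkovKernel Q ∧ (π : Measure (X × Y)) = μ ⊗ₘ Q} := by
  simp_rw [exists_isMarkovKernel_eq_compProd_iff_fst_eq]
  rw [← (isClosed_setOf_fst_eq μ).closure_eq]
  refine isCompact_closure_of_isTightMeasureSet (isTightMeasureSet_of_fst_eq (μ := μ) ?_)
  rintro _ ⟨π, hπ, rfl⟩
  exact hπ
end

section
/- Continuity and boundedness of mutual information under a dominated, continuous density assumption: let X, Y be Polish spaces, Q a Markov kernel from X to Y, and suppose there is a probability measure ν̄ on Y with Q(·|x) ≪ ν̄ for all x, with density ξ(x,y) = dQ(·|x)/dν̄(y) jointly continuous on X×Y, such that (x,y) ↦ ξ(x,y) log ξ(x,y) is uniformly integrable over the family {μ×ν̄ : μ ∈ K} for a weakly closed set K of input distributions, and for each fixed y the family {x ↦ ξ(x,y)} is uniformly integrable over K. Then μ ↦ I(μ;Q) = D(μ⊗Q ‖ μ×ν_μ) is bounded and weakly continuous on K. -/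
open MeasureTheory ProbabilityTheory ENNReal Filter Topology Classical

theorem continuousOn_integral_of_small_set_uniform {Z : Type*} [MeasurableSpace Z]
    [TopologicalSpace Z] [OpensMeasurableSpace Z] [HasOuterApproxClosed Z]
    {K : Set (ProbabilityMeasure Z)} {f : Z → ℝ} (hf : Continuous f)
    (hint : ∀ μ ∈ K, Integrable f (μ : Measure Z))
    (hUI : ∀ ε > (0 : ℝ), ∃ δ > (0 : ℝ), ∀ μ ∈ K, ∀ S : Set Z, MeasurableSet S →
      (μ : Measure Z) S ≤ ENNReal.ofReal δ → ∫ z in S, |f z| ∂(μ : Measure Z) ≤ ε) :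
    ContinuousOn (fun μ : ProbabilityMeasure Z => ∫ z, f z ∂(μ : Measure Z)) K := by
  intro μ hμ
  refine Metric.tendsto_nhds.2 fun ε hε => ?_
  obtain ⟨δ, hδ, hδK⟩ := hUI (ε / 4) (by positivity)
  obtain ⟨M, hM0, hM⟩ : ∃ M : ℝ, 0 ≤ M ∧
      (μ : Measure Z) {z | M ≤ |f z|} < ENNReal.ofReal δ := by
    have hI : 0 ≤ ∫ z, |f z| ∂(μ : Measure Z) := integral_nonneg fun z => abs_nonneg _
    set I := ∫ z, |f z| ∂(μ : Measure Z)
    refine ⟨(I + 1) / δ, by positivity, ?_⟩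
    have h := mul_meas_ge_le_integral_of_nonneg (μ := (μ : Measure Z))
      (ae_of_all _ fun z => abs_nonneg (f z)) (hint μ hμ).abs ((I + 1) / δ)
    rw [← ofReal_measureReal, ENNReal.ofReal_lt_ofReal_iff hδ]
    by_contra! hcon
    have : (I + 1) / δ * δ ≤ I := (mul_le_mul_of_nonneg_left hcon (by positivity)).trans h
    rw [div_mul_cancel₀ _ hδ.ne'] at this
    linarith
  set S : Set Z := {z | M ≤ |f z|}
  have hScl : IsClosed S := isClosed_le continuous_const hf.abs
  have hSm : ∀ᶠ ν : ProbabilityMeasure Z in 𝓝 μ, (ν : Measure Z) S < ENNReal.ofReal δ :=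
    eventually_lt_of_limsup_lt
      ((ProbabilityMeasure.limsup_measure_closed_le_of_tendsto tendsto_id hScl).trans_lt hM)
  let c : BoundedContinuousFunction Z ℝ :=
    BoundedContinuousFunction.ofNormedAddCommGroup (fun z => max (-M) (min M (f z)))
      (by fun_prop) M fun z => by
        rw [Real.norm_eq_abs, abs_le]
        exact ⟨le_max_left _ _, max_le (by linarith) (min_le_left _ _)⟩
  have hcf : ∀ z, c z = max (-M) (min M (f z)) := fun z => rfl
  have hdist : ∀ z, |f z - c z| ≤ S.indicator (fun z => |f z|) z := by
    intro z
    rw [hcf]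
    by_cases hz : z ∈ S
    · rw [Set.indicator_of_mem hz]
      rcases le_total 0 (f z) with h | h
      · have hz' : M ≤ f z := by simpa [S, abs_of_nonneg h] using hz
        rw [min_eq_left hz', max_eq_right (by linarith), abs_of_nonneg (by linarith),
          abs_of_nonneg h]
        linarith
      · have hz' : M ≤ -f z := by simpa [S, abs_of_nonpos h] using hz
        rw [min_eq_right (by linarith), max_eq_left (by linarith), abs_of_nonpos (by linarith),
          abs_of_nonpos h]
        linarith
    · rw [Set.indicator_of_notMem hz]
      have hz' : |f z| < M := not_le.1 hz
      rw [abs_lt] at hz'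
      rw [min_eq_right hz'.2.le, max_eq_right hz'.1.le, sub_self, abs_zero]
  have hclose : ∀ ν ∈ K, (ν : Measure Z) S < ENNReal.ofReal δ →
      |∫ z, f z ∂(ν : Measure Z) - ∫ z, c z ∂(ν : Measure Z)| ≤ ε / 4 := by
    intro ν hν hνS
    have hci : Integrable c (ν : Measure Z) := c.integrable _
    rw [← integral_sub (hint ν hν) hci]
    refine (abs_integral_le_integral_abs).trans (le_trans ?_ (hδK ν hν S hScl.measurableSet hνS.le))
    rw [← integral_indicator hScl.measurableSet]
    exact integral_mono ((hint ν hν).sub hci).abs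
      ((hint ν hν).abs.indicator hScl.measurableSet) hdist
  have hc := Metric.tendsto_nhds.1 ((ProbabilityMeasure.tendsto_iff_forall_integral_tendsto.1
    (tendsto_id (x := 𝓝 μ))) c) (ε / 4) (by positivity)
  filter_upwards [self_mem_nhdsWithin, nhdsWithin_le_nhds hSm, nhdsWithin_le_nhds hc]
    with ν hν hνS hνc
  have h1 := abs_le.1 (hclose ν hν hνS)
  have h2 := abs_le.1 (hclose μ hμ hM)
  rw [Real.dist_eq] at hνc ⊢
  have h3 := abs_lt.1 hνc
  simp only [id] at h3
  rw [abs_lt]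
  constructor <;> linarith [h1.1, h1.2, h2.1, h2.2, h3.1, h3.2]

theorem klDiv_withDensity_ofReal {Z : Type*} [MeasurableSpace Z] (B : Measure Z) [SigmaFinite B]
    {a b : Z → ℝ} (ha : Measurable a) (hb : Measurable b) (ha0 : ∀ z, 0 ≤ a z)
    (hb0 : ∀ z, 0 ≤ b z) (hab : ∀ᵐ z ∂B, b z = 0 → a z = 0)
    (hint : Integrable (fun z => a z * Real.log (a z) - a z * Real.log (b z)) B) :
    klDiv (B.withDensity fun z => ENNReal.ofReal (a z))
        (B.withDensity fun z => ENNReal.ofReal (b z))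
      = ENNReal.ofReal (∫ z, (a z * Real.log (a z) - a z * Real.log (b z)) ∂B) := by
  set P := B.withDensity fun z => ENNReal.ofReal (a z) with hP
  set R := B.withDensity fun z => ENNReal.ofReal (b z) with hR
  have hPR : P = R.withDensity fun z => ENNReal.ofReal (a z / b z) := by
    rw [hP, hR, ← withDensity_mul _ hb.ennreal_ofReal
      (g := fun z => ENNReal.ofReal (a z / b z)) (ha.div hb).ennreal_ofReal]
    refine withDensity_congr_ae ?_
    filter_upwards [hab] with z hz
    rw [Pi.mul_apply, ← ENNReal.ofReal_mul (hb0 z)]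
    by_cases h : b z = 0
    · simp [h, hz h]
    · rw [mul_div_cancel₀ _ h]
  have hac : P ≪ R := hPR ▸ withDensity_absolutelyContinuous _ _
  have hllr : llr P R =ᵐ[P] fun z => Real.log (a z / b z) := by
    have h : P.rnDeriv R =ᵐ[R] fun z => ENNReal.ofReal (a z / b z) := by
      rw [hPR]
      exact Measure.rnDeriv_withDensity R (ha.div hb).ennreal_ofReal
    filter_upwards [hac.ae_eq h] with z hz
    rw [llr, hz, ENNReal.toReal_ofReal (div_nonneg (ha0 z) (hb0 z))]
  have hmul : (fun z => (ENNReal.ofReal (a z)).toReal • Real.log (a z / b z)) =ᵐ[B]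
      fun z => a z * Real.log (a z) - a z * Real.log (b z) := by
    filter_upwards [hab] with z hz
    rw [ENNReal.toReal_ofReal (ha0 z), smul_eq_mul]
    by_cases h : a z = 0
    · simp [h]
    · rw [Real.log_div h (mt hz h), mul_sub]
  have hfin : ∀ᵐ z ∂B, ENNReal.ofReal (a z) < ⊤ := ae_of_all _ fun _ => ENNReal.ofReal_lt_top
  have hI : Integrable (llr P R) P := by
    rw [integrable_congr hllr, hP,
      integrable_withDensity_iff_integrable_smul' ha.ennreal_ofReal hfin, integrable_congr hmul]
    exact hint
  rw [klDiv, if_pos ⟨hac, hI⟩, integral_congr_ae hllr, hP,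
    integral_withDensity_eq_integral_toReal_smul ha.ennreal_ofReal hfin, integral_congr_ae hmul]

theorem abs_integral_mul_log_le {X : Type*} [MeasurableSpace X] {μ : Measure X}
    [IsProbabilityMeasure μ] {f : X → ℝ} (hf : ∀ x, 0 ≤ f x)
    (hint : Integrable f μ)
    (hlog : Integrable (fun x => f x * Real.log (f x)) μ) :
    |(∫ x, f x ∂μ) * Real.log (∫ x, f x ∂μ)|
      ≤ 1 + ∫ x, |f x * Real.log (f x)| ∂μ := by
  have hJ := Real.convexOn_mul_log.map_integral_le Real.continuous_mul_log.continuousOn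
    isClosed_Ici (ae_of_all _ hf) hint hlog
  have hle : ∫ x, f x * Real.log (f x) ∂μ
      ≤ ∫ x, |f x * Real.log (f x)| ∂μ :=
    integral_mono hlog hlog.abs fun x => le_abs_self _
  have h0 : 0 ≤ ∫ x, |f x * Real.log (f x)| ∂μ := integral_nonneg fun x => abs_nonneg _
  have hg : 0 ≤ ∫ x, f x ∂μ := integral_nonneg hf
  have hlow := Real.self_sub_one_le_mul_log hg
  rw [abs_le]
  constructor <;> linarith

section Density

variable {X Y : Type*} [MeasurableSpace X] [MeasurableSpace Y] {Q : Kernel X Y} [IsMarkovKernel Q]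
  {μ : Measure X} [IsProbabilityMeasure μ] {ν : Measure Y} [IsProbabilityMeasure ν] {ξ : X × Y → ℝ}

theorem compProd_eq_withDensity_prod (hξ : Measurable ξ)
    (hdens : ∀ x, Q x = ν.withDensity fun y => ENNReal.ofReal (ξ (x, y))) :
    μ ⊗ₘ Q = (μ.prod ν).withDensity fun z => ENNReal.ofReal (ξ z) := by
  ext s hs
  rw [Measure.compProd_apply hs, withDensity_apply _ hs, ← lintegral_indicator hs,
    lintegral_prod _ (hξ.ennreal_ofReal.indicator hs).aemeasurable]
  refine lintegral_congr fun x => ?_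
  rw [hdens, withDensity_apply _ (measurable_prodMk_left hs),
    ← lintegral_indicator (measurable_prodMk_left hs)]
  rfl

theorem integrable_density_prod (hξ : Measurable ξ)
    (hξpos : ∀ z, 0 ≤ ξ z) (hdens : ∀ x, Q x = ν.withDensity fun y => ENNReal.ofReal (ξ (x, y))) :
    Integrable ξ (μ.prod ν) ∧ ∫ z, ξ z ∂μ.prod ν = 1 := by
  have h1 : ∫⁻ z, ENNReal.ofReal (ξ z) ∂μ.prod ν = 1 := by
    rw [← setLIntegral_univ, ← withDensity_apply _ .univ,
      ← compProd_eq_withDensity_prod hξ hdens, measure_univ]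
  refine ⟨⟨hξ.aestronglyMeasurable, ?_⟩, ?_⟩
  · rw [hasFiniteIntegral_iff_ofReal (ae_of_all _ hξpos), h1]
    exact ENNReal.one_lt_top
  · rw [integral_eq_lintegral_of_nonneg_ae (ae_of_all _ hξpos) hξ.aestronglyMeasurable, h1,
      ENNReal.toReal_one]

theorem map_snd_compProd_eq_withDensity (hξ : Measurable ξ)
    (hξpos : ∀ z, 0 ≤ ξ z) (hdens : ∀ x, Q x = ν.withDensity fun y => ENNReal.ofReal (ξ (x, y)))
    (hint : ∀ y, Integrable (fun x => ξ (x, y)) μ) :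
    (μ ⊗ₘ Q).map Prod.snd = ν.withDensity fun y => ENNReal.ofReal (∫ x, ξ (x, y) ∂μ) := by
  ext t ht
  have hs : MeasurableSet (Prod.snd ⁻¹' t : Set (X × Y)) := measurable_snd ht
  rw [Measure.map_apply measurable_snd ht, compProd_eq_withDensity_prod hξ hdens,
    withDensity_apply _ hs, withDensity_apply _ ht, ← lintegral_indicator hs,
    lintegral_prod_symm _ (hξ.ennreal_ofReal.indicator hs).aemeasurable, ← lintegral_indicator ht]
  refine lintegral_congr fun y => ?_
  by_cases hy : y ∈ t
  · rw [Set.indicator_of_mem hy, ofReal_integral_eq_lintegral_ofReal (hint y)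
      (ae_of_all _ fun x => hξpos _)]
    exact lintegral_congr fun x => Set.indicator_of_mem (s := Prod.snd ⁻¹' t) hy _
  · rw [Set.indicator_of_notMem hy]
    have : ∀ x : X, (Prod.snd ⁻¹' t).indicator (fun z => ENNReal.ofReal (ξ z)) (x, y) = 0 :=
      fun x => Set.indicator_of_notMem (s := Prod.snd ⁻¹' t) hy _
    simp [this]

theorem integrable_marginal_mul_log (hξ : Measurable ξ) (hξpos : ∀ z, 0 ≤ ξ z)
    (hint : ∀ y, Integrable (fun x => ξ (x, y)) μ)
    (hlog : Integrable (fun z => ξ z * Real.log (ξ z)) (μ.prod ν)) :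
    Integrable (fun y => (∫ x, ξ (x, y) ∂μ) * Real.log (∫ x, ξ (x, y) ∂μ)) ν := by
  have hgm : Measurable fun y => ∫ x, ξ (x, y) ∂μ :=
    hξ.stronglyMeasurable.integral_prod_left'.measurable
  refine Integrable.mono' ((integrable_const 1).add hlog.abs.integral_prod_right)
    (Real.continuous_mul_log.measurable.comp hgm).aestronglyMeasurable ?_
  filter_upwards [hlog.prod_left_ae] with y hy
  exact abs_integral_mul_log_le (fun x => hξpos (x, y)) (hint y) hy

theorem mutualInfo_eq_of_density (hξ : Measurable ξ) (hξpos : ∀ z, 0 ≤ ξ z)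
    (hdens : ∀ x, Q x = ν.withDensity fun y => ENNReal.ofReal (ξ (x, y)))
    (hint : ∀ y, Integrable (fun x => ξ (x, y)) μ)
    (hlog : Integrable (fun z => ξ z * Real.log (ξ z)) (μ.prod ν)) :
    klDiv (μ ⊗ₘ Q) (μ.prod ((μ ⊗ₘ Q).map Prod.snd))
      = ENNReal.ofReal (∫ z, ξ z * Real.log (ξ z) ∂μ.prod ν
        - ∫ y, (∫ x, ξ (x, y) ∂μ) * Real.log (∫ x, ξ (x, y) ∂μ) ∂ν) := by
  have hg0 : ∀ y, 0 ≤ ∫ x, ξ (x, y) ∂μ := fun y => integral_nonneg fun x => hξpos _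
  have hgm : Measurable fun y => ∫ x, ξ (x, y) ∂μ :=
    hξ.stronglyMeasurable.integral_prod_left'.measurable
  have hglog := integrable_marginal_mul_log hξ hξpos hint hlog
  have hR : μ.prod ((μ ⊗ₘ Q).map Prod.snd)
      = (μ.prod ν).withDensity fun z => ENNReal.ofReal (∫ x, ξ (x, z.2) ∂μ) := by
    rw [map_snd_compProd_eq_withDensity hξ hξpos hdens hint,
      prod_withDensity_right hgm.ennreal_ofReal]
  have hcross_norm : ∀ y, ∫ x, ‖ξ (x, y) * Real.log (∫ x, ξ (x, y) ∂μ)‖ ∂μ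
      = ‖(∫ x, ξ (x, y) ∂μ) * Real.log (∫ x, ξ (x, y) ∂μ)‖ := by
    intro y
    simp_rw [norm_mul, Real.norm_of_nonneg (hξpos _), Real.norm_of_nonneg (hg0 y)]
    rw [integral_mul_const]
  have hcross : Integrable (fun z : X × Y => ξ z * Real.log (∫ x, ξ (x, z.2) ∂μ)) (μ.prod ν) := by
    have hm : Measurable fun z : X × Y => ξ z * Real.log (∫ x, ξ (x, z.2) ∂μ) :=
      hξ.mul (Real.measurable_log.comp (hgm.comp measurable_snd))
    exact (integrable_prod_iff' hm.aestronglyMeasurable).2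
      ⟨ae_of_all _ fun y => (hint y).mul_const (Real.log (∫ x, ξ (x, y) ∂μ)), hglog.norm.congr (ae_of_all _ fun y => (hcross_norm y).symm)⟩
  have hzero : ∀ᵐ z ∂μ.prod ν, ∫ x, ξ (x, z.2) ∂μ = 0 → ξ z = 0 := by
    have hset : MeasurableSet {z : X × Y | ∫ x, ξ (x, z.2) ∂μ = 0 → ξ z = 0} := by
      have h1 : MeasurableSet {z : X × Y | ∫ x, ξ (x, z.2) ∂μ = 0} :=
        (hgm.comp measurable_snd) (measurableSet_singleton 0)
      have h2 : MeasurableSet {z : X × Y | ξ z = 0} := hξ (measurableSet_singleton 0)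
      exact h1.imp h2
    rw [Measure.ae_prod_iff_ae_ae hset, Measure.ae_ae_comm hset]
    refine ae_of_all _ fun y => ?_
    by_cases hy : ∫ x, ξ (x, y) ∂μ = 0
    · filter_upwards [(integral_eq_zero_iff_of_nonneg (fun x => hξpos (x, y)) (hint y)).1 hy]
        with x hx _ using hx
    · exact ae_of_all _ fun x h => absurd h hy
  rw [hR, compProd_eq_withDensity_prod hξ hdens,
    klDiv_withDensity_ofReal _ hξ (b := fun z => ∫ x, ξ (x, z.2) ∂μ) (hgm.comp measurable_snd)
      hξpos (fun z => hg0 z.2) hzero (hlog.sub hcross),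
    integral_sub hlog hcross, integral_prod_symm _ hcross]
  simp_rw [integral_mul_const]

end Density

section Uniform

variable {X Y : Type*} [MeasurableSpace X] [MeasurableSpace Y]

theorem setIntegral_abs_marginal_mul_log_le {μ : Measure X} [IsProbabilityMeasure μ]
    {ν : Measure Y} [IsProbabilityMeasure ν] {ξ : X × Y → ℝ} (hξ : Measurable ξ)
    (hξpos : ∀ z, 0 ≤ ξ z) (hint : ∀ y, Integrable (fun x => ξ (x, y)) μ)
    (hlog : Integrable (fun z => ξ z * Real.log (ξ z)) (μ.prod ν)) (s : Set Y) :
    ∫ y in s, |(∫ x, ξ (x, y) ∂μ) * Real.log (∫ x, ξ (x, y) ∂μ)| ∂ν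
      ≤ ν.real s + ∫ z in Set.univ ×ˢ s, |ξ z * Real.log (ξ z)| ∂μ.prod ν := by
  have hprod : (μ.prod ν).restrict (Set.univ ×ˢ s) = μ.prod (ν.restrict s) := by
    rw [← Measure.prod_restrict, Measure.restrict_univ]
  have hI : Integrable (fun z => |ξ z * Real.log (ξ z)|) (μ.prod (ν.restrict s)) :=
    hprod ▸ hlog.abs.restrict
  have h1 : Integrable (fun _ : Y => (1 : ℝ)) (ν.restrict s) := integrable_const _
  rw [hprod, integral_prod_symm _ hI]
  calc _ ≤ ∫ y in s, (1 + ∫ x, |ξ (x, y) * Real.log (ξ (x, y))| ∂μ) ∂ν := by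
        refine integral_mono_ae
          (integrable_marginal_mul_log hξ hξpos hint hlog).abs.restrict
          (h1.add hI.integral_prod_right) ?_
        filter_upwards [ae_restrict_of_ae hlog.prod_left_ae] with y hy
        exact abs_integral_mul_log_le (fun x => hξpos (x, y)) (hint y) hy
    _ = _ := by rw [integral_add h1 hI.integral_prod_right]; simp

theorem exists_integral_mul_log_le {𝓜 : Set (Measure X)} {ξ : X → ℝ} (hξ : Measurable ξ)
    (hξpos : ∀ z, 0 ≤ ξ z) (hprob : ∀ μ ∈ 𝓜, IsProbabilityMeasure μ)
    (hone : ∀ μ ∈ 𝓜, Integrable ξ μ ∧ ∫ z, ξ z ∂μ = 1)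
    (hlog : ∀ μ ∈ 𝓜, Integrable (fun z => ξ z * Real.log (ξ z)) μ)
    (hUI : ∀ ε > (0 : ℝ), ∃ δ > (0 : ℝ), ∀ μ ∈ 𝓜, ∀ S : Set X, MeasurableSet S →
      μ S ≤ ENNReal.ofReal δ → ∫ z in S, |ξ z * Real.log (ξ z)| ∂μ ≤ ε) :
    ∃ C : ℝ, ∀ μ ∈ 𝓜, ∫ z, ξ z * Real.log (ξ z) ∂μ ≤ C := by
  obtain ⟨δ, hδ, hδK⟩ := hUI 1 one_pos
  obtain ⟨D, hD⟩ := (isCompact_Icc (a := (0 : ℝ)) (b := 1 / δ)).exists_bound_of_continuousOn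
    Real.continuous_mul_log.continuousOn
  have hD0 : 0 ≤ D := (norm_nonneg _).trans (hD 0 ⟨le_rfl, by positivity⟩)
  refine ⟨1 + D, fun μ hμ => ?_⟩
  have := hprob μ hμ
  have hS : MeasurableSet {z | 1 / δ ≤ ξ z} := measurableSet_le measurable_const hξ
  have hSδ : μ {z | 1 / δ ≤ ξ z} ≤ ENNReal.ofReal δ := by
    have h := mul_meas_ge_le_integral_of_nonneg (ae_of_all _ hξpos) (hone μ hμ).1 (1 / δ)
    rw [(hone μ hμ).2, one_div_mul_eq_div, div_le_one hδ] at h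
    rw [← ofReal_measureReal]
    exact ENNReal.ofReal_le_ofReal h
  have hind := (hlog μ hμ).abs.indicator hS
  calc ∫ z, ξ z * Real.log (ξ z) ∂μ
      ≤ ∫ z, ({z | 1 / δ ≤ ξ z}.indicator (fun z => |ξ z * Real.log (ξ z)|) z + D) ∂μ := by
        refine integral_mono (hlog μ hμ) (hind.add (integrable_const D)) fun z => ?_
        by_cases hz : 1 / δ ≤ ξ z
        · simp only [Set.indicator_of_mem (s := {z | 1 / δ ≤ ξ z}) hz]
          linarith [le_abs_self (ξ z * Real.log (ξ z))]
        · simp only [Set.indicator_of_notMem (s := {z | 1 / δ ≤ ξ z}) hz, zero_add]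
          exact (le_abs_self _).trans (hD _ ⟨hξpos z, (not_le.1 hz).le⟩)
    _ ≤ 1 + D := by
        rw [integral_add hind (integrable_const D), integral_indicator hS]
        simpa using hδK μ hμ _ hS hSδ

theorem continuousOn_integral_marginal_mul_log [TopologicalSpace X] [PolishSpace X] [BorelSpace X]
    [TopologicalSpace Y] [PolishSpace Y] [BorelSpace Y] {K : Set (ProbabilityMeasure X)}
    {ν : Measure Y} [IsProbabilityMeasure ν] {ξ : X × Y → ℝ} (hξpos : ∀ z, 0 ≤ ξ z)
    (hξ : Continuous ξ)
    (hlog : ∀ μ ∈ K, Integrable (fun z => ξ z * Real.log (ξ z)) ((μ : Measure X).prod ν))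
    (hlogUI : ∀ ε > (0 : ℝ), ∃ δ > (0 : ℝ), ∀ μ ∈ K, ∀ S : Set (X × Y), MeasurableSet S →
      ((μ : Measure X).prod ν) S ≤ ENNReal.ofReal δ →
        ∫ z in S, |ξ z * Real.log (ξ z)| ∂((μ : Measure X).prod ν) ≤ ε)
    (hint : ∀ y : Y, ∀ μ ∈ K, Integrable (fun x => ξ (x, y)) (μ : Measure X))
    (hUI : ∀ y : Y, ∀ ε > (0 : ℝ), ∃ δ > (0 : ℝ), ∀ μ ∈ K, ∀ S : Set X, MeasurableSet S →
      (μ : Measure X) S ≤ ENNReal.ofReal δ → ∫ x in S, ξ (x, y) ∂(μ : Measure X) ≤ ε) :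
    ContinuousOn (fun μ : ProbabilityMeasure X =>
      ∫ y, (∫ x, ξ (x, y) ∂(μ : Measure X)) * Real.log (∫ x, ξ (x, y) ∂(μ : Measure X)) ∂ν) K := by
  have hI := fun μ hμ => integrable_marginal_mul_log (μ := ((μ : ProbabilityMeasure X) : Measure X))
    hξ.measurable hξpos (fun y => hint y μ hμ) (hlog μ hμ)
  have hg : ∀ y, ContinuousOn
      (fun μ : ProbabilityMeasure X => ∫ x, ξ (x, y) ∂(μ : Measure X)) K := fun y =>
    continuousOn_integral_of_small_set_uniform (by fun_prop) (hint y)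
      (by simpa only [abs_of_nonneg (hξpos _)] using hUI y)
  rw [continuousOn_iff_continuous_domRestrict, continuous_iff_seqContinuous]
  intro u μ hu
  refine tendsto_integral_of_L1' _ (hI μ μ.2).aestronglyMeasurable
    (Eventually.of_forall fun n => hI (u n) (u n).2) ?_
  refine tendsto_Lp_finite_of_tendsto_ae le_rfl ENNReal.one_ne_top
    (fun n => (hI (u n) (u n).2).aestronglyMeasurable) (memLp_one_iff_integrable.2 (hI μ μ.2)) ?_
    (ae_of_all _ fun y => ?_)
  · intro ε hε
    obtain ⟨δ, hδ, hδK⟩ := hlogUI (ε / 2) (by positivity)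
    refine ⟨min δ (ε / 2), by positivity, fun n s hs hsδ => ?_⟩
    rw [eLpNorm_one_eq_lintegral_enorm,
      ← ofReal_integral_norm_eq_lintegral_enorm ((hI (u n) (u n).2).indicator hs)]
    refine ENNReal.ofReal_le_ofReal ?_
    simp_rw [norm_indicator_eq_indicator_norm]
    rw [integral_indicator hs]
    have hle := setIntegral_abs_marginal_mul_log_le hξ.measurable hξpos
      (fun y => hint y (u n) (u n).2) (hlog (u n) (u n).2) s
    have hs1 : ν.real s ≤ ε / 2 :=
      ENNReal.toReal_le_of_le_ofReal (by positivity)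
        (hsδ.trans (ENNReal.ofReal_le_ofReal (min_le_right _ _)))
    have hs2 := hδK (u n) (u n).2 (Set.univ ×ˢ s) (.prod .univ hs) (by
      rw [Measure.prod_prod, measure_univ, one_mul]
      exact hsδ.trans (ENNReal.ofReal_le_ofReal (min_le_left _ _)))
    simp only [Real.norm_eq_abs]
    linarith
  · exact (Real.continuous_mul_log.tendsto _).comp
      (((continuousOn_iff_continuous_domRestrict.1 (hg y)).tendsto μ).comp hu)

end Uniform

/-- Continuity and boundedness of mutual information under a dominated, jointly continuous
density assumption with uniform integrability over a weakly closed family `K` of input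
distributions. -/
theorem mutualInfo_bounded_and_weakly_continuous
    {X Y : Type*} [MeasurableSpace X] [TopologicalSpace X] [PolishSpace X] [BorelSpace X]
    [MeasurableSpace Y] [TopologicalSpace Y] [PolishSpace Y] [BorelSpace Y]
    (Q : Kernel X Y) [IsMarkovKernel Q]
    (K : Set (ProbabilityMeasure X)) (hKcl : IsClosed K)
    (nubar : Measure Y) [IsProbabilityMeasure nubar]
    (ξ : X × Y → ℝ) (hξpos : ∀ z, 0 ≤ ξ z) (hξcont : Continuous ξ)
    (hdens : ∀ x, Q x = nubar.withDensity fun y => ENNReal.ofReal (ξ (x, y)))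
    -- uniform integrability of `ξ log ξ` over the family `{μ × ν̄ : μ ∈ K}`:
    (hUI₁ : (∀ μ ∈ K, Integrable (fun z => ξ z * Real.log (ξ z))
        ((μ : Measure X).prod nubar)) ∧
      ∀ ε > (0 : ℝ), ∃ δ > (0 : ℝ), ∀ μ ∈ K, ∀ S : Set (X × Y), MeasurableSet S →
        ((μ : Measure X).prod nubar) S ≤ ENNReal.ofReal δ →
        ∫ z in S, |ξ z * Real.log (ξ z)| ∂((μ : Measure X).prod nubar) ≤ ε)
    -- for each fixed `y`, uniform integrability of `x ↦ ξ (x,y)` over `K`: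
    (hUI₂ : (∀ y : Y, ∀ μ ∈ K, Integrable (fun x => ξ (x, y)) (μ : Measure X)) ∧
      ∀ y : Y, ∀ ε > (0 : ℝ), ∃ δ > (0 : ℝ), ∀ μ ∈ K, ∀ S : Set X, MeasurableSet S →
        (μ : Measure X) S ≤ ENNReal.ofReal δ →
        ∫ x in S, ξ (x, y) ∂(μ : Measure X) ≤ ε) :
    (∃ C : ℝ, ∀ μ ∈ K,
      klDiv ((μ : Measure X) ⊗ₘ Q)
          ((μ : Measure X).prod (((μ : Measure X) ⊗ₘ Q).map Prod.snd))
        ≤ ENNReal.ofReal C)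
    ∧ ContinuousOn
        (fun μ : ProbabilityMeasure X =>
          klDiv ((μ : Measure X) ⊗ₘ Q)
            ((μ : Measure X).prod (((μ : Measure X) ⊗ₘ Q).map Prod.snd))) K := by
  obtain ⟨hlog, hlogUI⟩ := hUI₁
  obtain ⟨hint, hUI⟩ := hUI₂
  have hξm := hξcont.measurable
  have hformula := fun (μ : ProbabilityMeasure X) (hμ : μ ∈ K) =>
    mutualInfo_eq_of_density (μ := (μ : Measure X)) hξm hξpos hdens (fun y => hint y μ hμ)
      (hlog μ hμ)
  constructor
  · obtain ⟨C, hC⟩ := exists_integral_mul_log_le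
      (𝓜 := (fun μ : ProbabilityMeasure X => (μ : Measure X).prod nubar) '' K) hξm hξpos
      (by rintro _ ⟨μ, -, rfl⟩; infer_instance)
      (by rintro _ ⟨μ, -, rfl⟩; exact integrable_density_prod hξm hξpos hdens)
      (by rintro _ ⟨μ, hμ, rfl⟩; exact hlog μ hμ)
      (by simpa only [Set.forall_mem_image] using hlogUI)
    refine ⟨C + 1, fun μ hμ => ?_⟩
    rw [hformula μ hμ]
    refine ENNReal.ofReal_le_ofReal ?_
    have h1 : ∫ _, (-1 : ℝ) ∂nubar ≤ ∫ y, (∫ x, ξ (x, y) ∂(μ : Measure X)) *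
        Real.log (∫ x, ξ (x, y) ∂(μ : Measure X)) ∂nubar := by
      refine integral_mono (integrable_const _)
        (integrable_marginal_mul_log hξm hξpos (fun y => hint y μ hμ) (hlog μ hμ)) fun y => ?_
      have h0 : 0 ≤ ∫ x, ξ (x, y) ∂(μ : Measure X) := integral_nonneg fun x => hξpos _
      have := Real.self_sub_one_le_mul_log h0
      simp only
      linarith
    have h2 := hC _ ⟨μ, hμ, rfl⟩
    simp only [integral_const, probReal_univ, one_smul] at h1
    linarith
  · refine ContinuousOn.congr ?_ hformula
    refine ENNReal.continuous_ofReal.comp_continuousOn (ContinuousOn.sub ?_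
      (continuousOn_integral_marginal_mul_log hξpos hξcont hlog hlogUI hint hUI))
    let N : ProbabilityMeasure Y := ⟨nubar, inferInstance⟩
    have hprod : Continuous fun μ : ProbabilityMeasure X => μ.prod N :=
      ProbabilityMeasure.continuous_prod.comp (by fun_prop : Continuous fun μ => (μ, N))
    have hcont := continuousOn_integral_of_small_set_uniform
      (K := (fun μ : ProbabilityMeasure X => μ.prod N) '' K)
      (f := fun z => ξ z * Real.log (ξ z)) (Real.continuous_mul_log.comp hξcont)
      (by rintro _ ⟨μ, hμ, rfl⟩; exact hlog μ hμ)
      (by simp only [Set.forall_mem_image]; exact hlogUI)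
    exact hcont.comp hprod.continuousOn (Set.mapsTo_image _ _)
end

section
/- Existence of a rate-distortion-achieving kernel (single-letter nonanticipative version): let X be a Polish space, Y a compact Polish space, μ a probability measure on X, and d : X×Y → [0,∞) bounded and continuous. If the set Q(D) = {Q kernel from X to Y : ∫ d d(μ⊗Q) ≤ D} is nonempty, then the infimum R(D) = inf_{Q∈Q(D)} D(μ⊗Q ‖ μ×ν_Q) is attained by some kernel Q* ∈ Q(D). -/
open MeasureTheory ProbabilityTheory ENNReal Filter Topology Classical

/-- The objective of the variational formula for the Kullback–Leibler divergence, at the test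
function `g`. -/
noncomputable def klDual {Z : Type*} [MeasurableSpace Z] (μ ν : Measure Z) (g : Z → ℝ) : ℝ :=
  ∫ z, g z ∂μ - ∫ z, (Real.exp (g z) - 1) ∂ν

section KLDual

variable {Z : Type*} [MeasurableSpace Z] {μ ν : Measure Z}

theorem klDiv_eq_informationTheory_klDiv_s16 [IsProbabilityMeasure μ] [IsProbabilityMeasure ν] :
    klDiv μ ν = InformationTheory.klDiv μ ν := by
  simp [klDiv, InformationTheory.klDiv_def]

theorem integrable_of_measurable_of_abs_le [IsFiniteMeasure μ] {g : Z → ℝ} (hg : Measurable g)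
    {M : ℝ} (hM : ∀ z, |g z| ≤ M) : Integrable g μ :=
  Integrable.of_bound hg.aestronglyMeasurable M (.of_forall hM)

theorem integrable_exp_sub_one_of_abs_le [IsFiniteMeasure μ] {g : Z → ℝ} (hg : Measurable g)
    {M : ℝ} (hM : ∀ z, |g z| ≤ M) : Integrable (fun z ↦ Real.exp (g z) - 1) μ := by
  refine Integrable.sub (integrable_of_measurable_of_abs_le hg.exp (M := Real.exp M) fun z ↦ ?_)
    (integrable_const _)
  rw [Real.abs_exp]
  exact Real.exp_le_exp.2 ((le_abs_self _).trans (hM z))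

/-- The Fenchel–Young inequality for `klFun`. -/
theorem mul_sub_exp_sub_one_le_klFun {u : ℝ} (hu : 0 ≤ u) (g : ℝ) :
    u * g - (Real.exp g - 1) ≤ InformationTheory.klFun u := by
  rw [InformationTheory.klFun_apply]
  rcases hu.eq_or_lt with rfl | hu
  · simp [(Real.exp_pos g).le]
  · have h := Real.add_one_le_exp (g - Real.log u)
    rw [Real.exp_sub, Real.exp_log hu, le_div_iff₀ hu] at h
    linarith

theorem integrable_rnDeriv_mul_of_abs_le [IsFiniteMeasure μ] [IsFiniteMeasure ν] {g : Z → ℝ}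
    (hg : Measurable g) {M : ℝ} (hM : ∀ z, |g z| ≤ M) :
    Integrable (fun z ↦ (μ.rnDeriv ν z).toReal * g z) ν :=
  Measure.integrable_toReal_rnDeriv.mul_bdd hg.aestronglyMeasurable (.of_forall hM)

theorem klDual_eq_integral_rnDeriv [IsFiniteMeasure μ] [IsFiniteMeasure ν] (hμν : μ ≪ ν)
    {g : Z → ℝ} (hg : Measurable g) {M : ℝ} (hM : ∀ z, |g z| ≤ M) :
    klDual μ ν g = ∫ z, ((μ.rnDeriv ν z).toReal * g z - (Real.exp (g z) - 1)) ∂ν := by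
  rw [integral_sub (integrable_rnDeriv_mul_of_abs_le hg hM)
    (integrable_exp_sub_one_of_abs_le hg hM), klDual, ← integral_rnDeriv_smul hμν]
  simp only [smul_eq_mul]

theorem ofReal_klDual_le_klDiv [IsFiniteMeasure μ] [IsFiniteMeasure ν] {g : Z → ℝ}
    (hg : Measurable g) {M : ℝ} (hM : ∀ z, |g z| ≤ M) :
    ENNReal.ofReal (klDual μ ν g) ≤ InformationTheory.klDiv μ ν := by
  by_cases h : μ ≪ ν ∧ Integrable (llr μ ν) μ
  · rw [InformationTheory.klDiv_eq_integral_klFun, if_pos h, klDual_eq_integral_rnDeriv h.1 hg hM]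
    refine ENNReal.ofReal_le_ofReal (integral_mono ?_ ?_ fun z ↦ ?_)
    · exact (integrable_rnDeriv_mul_of_abs_le hg hM).sub (integrable_exp_sub_one_of_abs_le hg hM)
    · exact (InformationTheory.integrable_klFun_rnDeriv_iff h.1).2 h.2
    · exact mul_sub_exp_sub_one_le_klFun ENNReal.toReal_nonneg _
  · rw [InformationTheory.klDiv_def, if_neg h]
    exact le_top

/-- A bound on `klDual` over bounded continuous functions extends to bounded measurable ones. -/
theorem klDual_le_of_forall_boundedContinuous [TopologicalSpace Z] [NormalSpace Z] [BorelSpace Z]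
    [IsFiniteMeasure μ] [IsFiniteMeasure ν] [(μ + ν).WeaklyRegular] {s : ℝ}
    (hs : ∀ g : BoundedContinuousFunction Z ℝ, klDual μ ν g ≤ s)
    {g : Z → ℝ} (hg : Measurable g) {M : ℝ} (hM0 : 0 ≤ M) (hM : ∀ z, |g z| ≤ M) :
    klDual μ ν g ≤ s := by
  refine le_of_forall_pos_le_add fun ε hε ↦ ?_
  have hE : 0 < 1 + Real.exp M := by positivity
  obtain ⟨h, hh, hhi⟩ := (integrable_of_measurable_of_abs_le (μ := μ + ν) hg hM)
    |>.exists_boundedContinuous_integral_sub_le (div_pos hε hE)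
  let k : BoundedContinuousFunction Z ℝ := BoundedContinuousFunction.ofNormedAddCommGroup
    (fun z ↦ max (-M) (min M (h z))) (by fun_prop) M fun z ↦ abs_le.2 ⟨le_max_left _ _,
      max_le (by linarith) (min_le_left _ _)⟩
  have hk_apply (z) : k z = max (-M) (min M (h z)) := rfl
  have hkM (z) : |k z| ≤ M := k.norm_coe_le_norm z |>.trans
    (BoundedContinuousFunction.norm_ofNormedAddCommGroup_le _ hM0 _)
  have hkm : Measurable k := k.continuous.measurable
  have hgk (z) : |g z - k z| ≤ ‖g z - h z‖ := by
    have := abs_le.1 (hM z)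
    rw [hk_apply, Real.norm_eq_abs]
    grind
  have hexp (z) : Real.exp (k z) - Real.exp (g z) ≤ Real.exp M * ‖g z - h z‖ := by
    have h1 := Real.add_one_le_exp (g z - k z)
    rw [Real.exp_sub, le_div_iff₀ (Real.exp_pos _)] at h1
    have h2 : Real.exp (k z) ≤ Real.exp M := Real.exp_le_exp.2 ((le_abs_self _).trans (hkM z))
    calc Real.exp (k z) - Real.exp (g z) ≤ Real.exp (k z) * -(g z - k z) := by linarith
      _ ≤ Real.exp (k z) * |g z - k z| := by gcongr; exact neg_le_abs _
      _ ≤ _ := by gcongr; exact hgk z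
  have hni : Integrable (fun z ↦ ‖g z - h z‖) (μ + ν) :=
    ((integrable_of_measurable_of_abs_le hg hM).sub hhi).norm
  have hniμ := hni.mono_measure (Measure.le_add_right le_rfl : μ ≤ μ + ν)
  have hniν := hni.mono_measure (Measure.le_add_left le_rfl : ν ≤ μ + ν)
  rw [integral_add_measure hniμ hniν, le_div_iff₀ hE] at hh
  have hμ : ∫ z, g z ∂μ - ∫ z, k z ∂μ ≤ ∫ z, ‖g z - h z‖ ∂μ := by
    rw [← integral_sub (integrable_of_measurable_of_abs_le hg hM)
      (integrable_of_measurable_of_abs_le hkm hkM)]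
    exact integral_mono ((integrable_of_measurable_of_abs_le hg hM).sub
      (integrable_of_measurable_of_abs_le hkm hkM)) hniμ fun z ↦ (le_abs_self _).trans (hgk z)
  have hν : ∫ z, (Real.exp (k z) - 1) ∂ν - ∫ z, (Real.exp (g z) - 1) ∂ν
      ≤ Real.exp M * ∫ z, ‖g z - h z‖ ∂ν := by
    rw [← integral_sub (integrable_exp_sub_one_of_abs_le hkm hkM)
      (integrable_exp_sub_one_of_abs_le hg hM), ← integral_const_mul]
    exact integral_mono ((integrable_exp_sub_one_of_abs_le hkm hkM).sub
      (integrable_exp_sub_one_of_abs_le hg hM)) (hniν.const_mul _) fun z ↦ by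
        have := hexp z
        simp only at this ⊢
        linarith
  have hk := hs k
  have h_nonneg_μ : 0 ≤ ∫ z, ‖g z - h z‖ ∂μ := integral_nonneg fun _ ↦ norm_nonneg _
  have h_nonneg_ν : 0 ≤ ∫ z, ‖g z - h z‖ ∂ν := integral_nonneg fun _ ↦ norm_nonneg _
  have := mul_nonneg h_nonneg_μ (Real.exp_pos M).le
  rw [klDual] at hk ⊢
  linarith

/-- Absolute continuity follows from a bound on `klDual` over bounded measurable functions. -/
theorem absolutelyContinuous_of_klDual_le [IsFiniteMeasure μ] {s : ℝ}
    (hs : ∀ g : Z → ℝ, Measurable g → (∃ M : ℝ, 0 ≤ M ∧ ∀ z, |g z| ≤ M) → klDual μ ν g ≤ s) :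
    μ ≪ ν := by
  refine Measure.AbsolutelyContinuous.mk fun A hA hνA ↦ ?_
  by_contra hμA
  have hpos : 0 < μ.real A := ENNReal.toReal_pos hμA (measure_ne_top _ _)
  obtain ⟨n, hn⟩ := exists_nat_gt (s / μ.real A)
  rw [div_lt_iff₀ hpos] at hn
  refine hn.not_ge ?_
  have hind (z) : |A.indicator (fun _ ↦ (n : ℝ)) z| ≤ n := by
    by_cases hz : z ∈ A <;> simp [hz]
  have h := hs (A.indicator fun _ ↦ (n : ℝ)) (measurable_const.indicator hA)
    ⟨n, Nat.cast_nonneg n, hind⟩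
  have h0 : ∫ z, (Real.exp (A.indicator (fun _ ↦ (n : ℝ)) z) - 1) ∂ν = 0 := by
    refine integral_eq_zero_of_ae ?_
    filter_upwards [compl_mem_ae_iff.2 hνA] with z hz
    simp [Set.indicator_of_notMem hz]
  rw [klDual, h0, integral_indicator_const _ hA, smul_eq_mul] at h
  linarith

/-- `u` clipped to the interval `[exp (-n), exp n]`. -/
noncomputable def expClip (n : ℕ) (u : ℝ) : ℝ := max (Real.exp (-n)) (min u (Real.exp n))

theorem expClip_pos (n : ℕ) (u : ℝ) : 0 < expClip n u :=
  lt_max_of_lt_left (Real.exp_pos _)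

theorem abs_log_expClip_le (n : ℕ) (u : ℝ) : |Real.log (expClip n u)| ≤ n := by
  have hn : Real.exp (-n) ≤ Real.exp n := Real.exp_le_exp.2 (by linarith [n.cast_nonneg (α := ℝ)])
  rw [abs_le, Real.le_log_iff_exp_le (expClip_pos n u), Real.log_le_iff_le_exp (expClip_pos n u)]
  exact ⟨le_max_left _ _, max_le hn (min_le_right _ _)⟩

theorem measurable_expClip (n : ℕ) : Measurable (expClip n) := by
  unfold expClip
  fun_prop

theorem mul_log_expClip_nonneg (n : ℕ) (u : ℝ) :
    0 ≤ u * Real.log (expClip n u) - (expClip n u - 1) := by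
  have hc := expClip_pos n u
  have hk := InformationTheory.klFun_nonneg hc.le
  rw [InformationTheory.klFun_apply] at hk
  suffices 0 ≤ (u - expClip n u) * Real.log (expClip n u) by linarith
  have h1 : Real.exp (-n) ≤ 1 := Real.exp_le_one_iff.2 (by simp)
  have h2 : 1 ≤ Real.exp n := Real.one_le_exp (by simp)
  rcases le_total u (expClip n u) with h | h
  · rcases h.eq_or_lt with h | h
    · simp [← h]
    · refine mul_nonneg_of_nonpos_of_nonpos (by linarith) (Real.log_nonpos hc.le ?_)
      unfold expClip at h ⊢
      grind
  · rcases h.eq_or_lt with h | h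
    · simp [h]
    · refine mul_nonneg (by linarith) (Real.log_nonneg ?_)
      unfold expClip at h ⊢
      grind

theorem tendsto_expClip {u : ℝ} (hu : 0 ≤ u) : Tendsto (fun n ↦ expClip n u) atTop (𝓝 u) := by
  have h1 : Tendsto (fun n : ℕ ↦ Real.exp (-n)) atTop (𝓝 0) :=
    Real.tendsto_exp_neg_atTop_nhds_zero.comp tendsto_natCast_atTop_atTop
  have h2 : Tendsto (fun n : ℕ ↦ Real.exp n) atTop atTop :=
    Real.tendsto_exp_atTop.comp tendsto_natCast_atTop_atTop
  have h3 : Tendsto (fun n : ℕ ↦ min u (Real.exp n)) atTop (𝓝 u) := by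
    refine tendsto_const_nhds.congr' ?_
    filter_upwards [h2.eventually_ge_atTop u] with n hn
    rw [min_eq_left hn]
  simpa [hu, expClip] using h1.max h3

theorem tendsto_mul_log_expClip {u : ℝ} (hu : 0 ≤ u) :
    Tendsto (fun n ↦ u * Real.log (expClip n u) - (expClip n u - 1)) atTop
      (𝓝 (InformationTheory.klFun u)) := by
  have hc := tendsto_expClip hu
  have : InformationTheory.klFun u = u * Real.log u - (u - 1) := by
    rw [InformationTheory.klFun_apply]
    ring
  rw [this]
  refine Tendsto.sub ?_ (hc.sub_const 1)
  rcases hu.eq_or_lt with rfl | hu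
  · simp
  · exact (hc.log hu.ne').const_mul u

theorem klDiv_le_of_klDual_le [IsFiniteMeasure μ] [IsFiniteMeasure ν] {s : ℝ}
    (hs : ∀ g : Z → ℝ, Measurable g → (∃ M : ℝ, 0 ≤ M ∧ ∀ z, |g z| ≤ M) → klDual μ ν g ≤ s) :
    InformationTheory.klDiv μ ν ≤ ENNReal.ofReal s := by
  have hμν := absolutelyContinuous_of_klDual_le hs
  rw [InformationTheory.klDiv_eq_lintegral_klFun_of_ac hμν]
  set f : Z → ℝ := fun z ↦ (μ.rnDeriv ν z).toReal
  have hfm : Measurable f := (Measure.measurable_rnDeriv μ ν).ennreal_toReal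
  let F (n : ℕ) (z : Z) : ℝ := f z * Real.log (expClip n (f z)) - (expClip n (f z) - 1)
  have hFm (n) : Measurable (F n) :=
    (hfm.mul ((measurable_expClip n).comp hfm).log).sub
      (((measurable_expClip n).comp hfm).sub_const 1)
  have hF (n) : ∫⁻ z, ENNReal.ofReal (F n z) ∂ν ≤ ENNReal.ofReal s := by
    have hgm : Measurable fun z ↦ Real.log (expClip n (f z)) :=
      ((measurable_expClip n).comp hfm).log
    have hgb (z) : |Real.log (expClip n (f z))| ≤ n := abs_log_expClip_le n _
    have hint := (integrable_rnDeriv_mul_of_abs_le (μ := μ) (ν := ν) hgm hgb).sub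
      (integrable_exp_sub_one_of_abs_le hgm hgb)
    have hval := klDual_eq_integral_rnDeriv hμν hgm hgb
    simp only [Real.exp_log (expClip_pos _ _), Pi.sub_def] at hval hint
    rw [← ofReal_integral_eq_lintegral_ofReal hint (.of_forall fun z ↦ mul_log_expClip_nonneg n _),
      ← hval]
    exact ENNReal.ofReal_le_ofReal (hs _ hgm ⟨n, Nat.cast_nonneg n, hgb⟩)
  calc ∫⁻ z, ENNReal.ofReal (InformationTheory.klFun (f z)) ∂ν
      = ∫⁻ z, liminf (fun n ↦ ENNReal.ofReal (F n z)) atTop ∂ν := lintegral_congr fun z ↦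
        ((ENNReal.tendsto_ofReal
          (tendsto_mul_log_expClip (u := f z) ENNReal.toReal_nonneg)).liminf_eq).symm
    _ ≤ liminf (fun n ↦ ∫⁻ z, ENNReal.ofReal (F n z) ∂ν) atTop :=
        lintegral_liminf_le fun n ↦ (hFm n).ennreal_ofReal
    _ ≤ ENNReal.ofReal s := liminf_le_of_le (by isBoundedDefault) fun b hb ↦ by
        obtain ⟨n, hn⟩ := hb.exists
        exact hn.trans (hF n)

/-- Variational formula for the Kullback–Leibler divergence. -/
theorem klDiv_eq_iSup_klDual [TopologicalSpace Z] [NormalSpace Z] [BorelSpace Z]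
    [IsFiniteMeasure μ] [IsFiniteMeasure ν] [(μ + ν).WeaklyRegular] :
    InformationTheory.klDiv μ ν =
      ⨆ g : BoundedContinuousFunction Z ℝ, ENNReal.ofReal (klDual μ ν g) := by
  refine le_antisymm ?_ (iSup_le fun g ↦
    ofReal_klDual_le_klDiv g.continuous.measurable g.norm_coe_le_norm)
  set S := ⨆ g : BoundedContinuousFunction Z ℝ, ENNReal.ofReal (klDual μ ν g)
  by_cases hST : S = ⊤
  · simp [hST]
  rw [← ENNReal.ofReal_toReal hST]
  refine klDiv_le_of_klDual_le fun g hg ⟨M, hM0, hM⟩ ↦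
    klDual_le_of_forall_boundedContinuous (fun k ↦ ?_) hg hM0 hM
  rw [← ENNReal.ofReal_le_iff_le_toReal hST]
  exact le_iSup (fun g : BoundedContinuousFunction Z ℝ ↦ ENNReal.ofReal (klDual μ ν g)) k

end KLDual

/-- The Kullback–Leibler divergence is jointly weakly lower semicontinuous. -/
theorem lowerSemicontinuous_klDiv {Z : Type*} [MeasurableSpace Z] [TopologicalSpace Z]
    [TopologicalSpace.PseudoMetrizableSpace Z] [BorelSpace Z] :
    LowerSemicontinuous fun p : ProbabilityMeasure Z × ProbabilityMeasure Z ↦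
      klDiv (p.1 : Measure Z) (p.2 : Measure Z) := by
  simp only [klDiv_eq_informationTheory_klDiv_s16, klDiv_eq_iSup_klDual]
  refine lowerSemicontinuous_iSup fun g ↦ Continuous.lowerSemicontinuous ?_
  have hexp : ∃ k : BoundedContinuousFunction Z ℝ, ∀ z, k z = Real.exp (g z) - 1 := by
    refine ⟨BoundedContinuousFunction.ofNormedAddCommGroup (fun z ↦ Real.exp (g z) - 1)
      (by fun_prop) (Real.exp ‖g‖ + 1) fun z ↦ ?_, fun z ↦ rfl⟩
    refine (norm_sub_le _ _).trans ?_
    rw [Real.norm_eq_abs, Real.abs_exp, norm_one]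
    gcongr
    exact (le_abs_self _).trans (g.norm_coe_le_norm z)
  obtain ⟨k, hk⟩ := hexp
  simp only [klDual, ← hk]
  exact ENNReal.continuous_ofReal.comp
    (((ProbabilityMeasure.continuous_integral_boundedContinuousFunction g).comp continuous_fst).sub
      ((ProbabilityMeasure.continuous_integral_boundedContinuousFunction k).comp continuous_snd))

section Coupling

variable {X Y : Type*} [MeasurableSpace X] [TopologicalSpace X] [PolishSpace X] [BorelSpace X]
  [MeasurableSpace Y] [TopologicalSpace Y] [PolishSpace Y] [BorelSpace Y]

/-- The joint laws with a prescribed first marginal and a compact second factor form a weakly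
compact set. -/
theorem isCompact_setOf_map_fst_eq [CompactSpace Y] (μ : ProbabilityMeasure X) :
    IsCompact {P : ProbabilityMeasure (X × Y) | P.map measurable_fst.aemeasurable = μ} := by
  have hclosed :
      IsClosed {P : ProbabilityMeasure (X × Y) | P.map measurable_fst.aemeasurable = μ} :=
    isClosed_singleton.preimage (ProbabilityMeasure.continuous_map continuous_fst)
  rw [← hclosed.closure_eq]
  refine isCompact_closure_of_isTightMeasureSet (IsTightMeasureSet.prodMk ?_ .of_compactSpace)
  refine (isTightMeasureSet_singleton (μ := (μ : Measure X))).subset ?_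
  rintro _ ⟨_, ⟨P, hP, rfl⟩, rfl⟩
  exact congrArg (fun ν : ProbabilityMeasure X ↦ (ν : Measure X)) hP

/-- Mutual information, as a function of the joint law with fixed reference first marginal, is
weakly lower semicontinuous. -/
theorem lowerSemicontinuous_klDiv_prod_snd (μ : ProbabilityMeasure X) :
    LowerSemicontinuous fun P : ProbabilityMeasure (X × Y) ↦
      klDiv (P : Measure (X × Y)) ((μ : Measure X).prod ((P : Measure (X × Y)).map Prod.snd)) := by
  have hcont : Continuous fun P : ProbabilityMeasure (X × Y) ↦
      (P, μ.prod (P.map measurable_snd.aemeasurable)) :=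
    continuous_id.prodMk (ProbabilityMeasure.continuous_prod.comp
      (continuous_const.prodMk (ProbabilityMeasure.continuous_map continuous_snd)))
  exact lowerSemicontinuous_klDiv.comp hcont

end Coupling

/-- Existence of a rate-distortion-achieving kernel (single-letter nonanticipative
version): if the constraint set `{Q : ∫ d d(μ⊗Q) ≤ D}` is nonempty, the infimum of
`Q ↦ D(μ⊗Q ‖ μ×ν_Q)` over it is attained. -/
theorem exists_rate_distortion_achieving_kernel
    {X Y : Type*} [MeasurableSpace X] [TopologicalSpace X] [PolishSpace X] [BorelSpace X]
    [MeasurableSpace Y] [TopologicalSpace Y] [PolishSpace Y] [BorelSpace Y] [CompactSpace Y]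
    (μ : Measure X) [IsProbabilityMeasure μ]
    (d : X × Y → ℝ) (hd : Continuous d) (hd0 : ∀ z, 0 ≤ d z)
    (hdbdd : ∃ C : ℝ, ∀ z, d z ≤ C)
    (D : ℝ)
    (hne : ∃ Q : Kernel X Y, IsMarkovKernel Q ∧ ∫ z, d z ∂(μ ⊗ₘ Q) ≤ D) :
    ∃ Qstar : Kernel X Y, IsMarkovKernel Qstar ∧ (∫ z, d z ∂(μ ⊗ₘ Qstar) ≤ D) ∧
      ∀ Q : Kernel X Y, IsMarkovKernel Q → ∫ z, d z ∂(μ ⊗ₘ Q) ≤ D →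
        klDiv (μ ⊗ₘ Qstar) (μ.prod ((μ ⊗ₘ Qstar).map Prod.snd))
          ≤ klDiv (μ ⊗ₘ Q) (μ.prod ((μ ⊗ₘ Q).map Prod.snd)) := by
  obtain ⟨C, hC⟩ := hdbdd
  let m : ProbabilityMeasure X := ⟨μ, inferInstance⟩
  let joint (Q : Kernel X Y) (_ : IsMarkovKernel Q) : ProbabilityMeasure (X × Y) :=
    ⟨μ ⊗ₘ Q, inferInstance⟩
  let K : Set (ProbabilityMeasure (X × Y)) :=
    {P | P.map measurable_fst.aemeasurable = m} ∩ {P | ∫ z, d z ∂(P : Measure (X × Y)) ≤ D}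
  let db : BoundedContinuousFunction (X × Y) ℝ :=
    BoundedContinuousFunction.ofNormedAddCommGroup d hd C fun z ↦ by
      rw [Real.norm_eq_abs, abs_of_nonneg (hd0 z)]
      exact hC z
  have hKcompact : IsCompact K := (isCompact_setOf_map_fst_eq m).inter_right
    (isClosed_Iic.preimage
      (ProbabilityMeasure.continuous_integral_boundedContinuousFunction db))
  have hjoint (Q : Kernel X Y) (hQ : IsMarkovKernel Q) (hQD : ∫ z, d z ∂(μ ⊗ₘ Q) ≤ D) :
      joint Q hQ ∈ K :=
    ⟨Subtype.ext (Measure.fst_compProd μ Q), hQD⟩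
  obtain ⟨Q₀, hQ₀, hQ₀D⟩ := hne
  obtain ⟨P, ⟨hPfst, hPD⟩, hPmin⟩ := LowerSemicontinuousOn.exists_isMinOn
    ⟨_, hjoint Q₀ hQ₀ hQ₀D⟩ hKcompact
    ((lowerSemicontinuous_klDiv_prod_snd m).lowerSemicontinuousOn K)
  have hX : Nonempty X := nonempty_of_isProbabilityMeasure μ
  have hY : Nonempty Y := hX.elim fun x ↦ nonempty_of_isProbabilityMeasure (Q₀ x)
  have hdis : μ ⊗ₘ (P : Measure (X × Y)).condKernel = P := by
    have hfst : (P : Measure (X × Y)).fst = μ :=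
      congrArg (fun ν : ProbabilityMeasure X ↦ (ν : Measure X)) hPfst
    conv_lhs => rw [← hfst]
    exact (P : Measure (X × Y)).disintegrate _
  refine ⟨(P : Measure (X × Y)).condKernel, inferInstance, ?_, fun Q hQ hQD ↦ ?_⟩
  · rw [hdis]
    exact hPD
  · rw [hdis]
    exact hPmin (hjoint Q hQ hQD)
end
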